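/- Let σ > 0, 2 ≤ q ≤ ∞, δ > 0, a ∈ ℝ, and let f be a Schwartz function on ℝ. Then for λ ≫ 1, ‖ f(·/λ^δ) cos(λ· − a) ‖_{B^σ_{2,q}(ℝ)} ≍ λ^{σ + δ/2} ‖f‖_{L²(ℝ)}, with implicit constants independent of λ and a; the same holds with sin(λ· − a) in place of cos(λ· − a). -/

import Mathlib

open MeasureTheory ENNReal

/-- The `m`-th iterated finite difference `Δ_h^m`. -/
noncomputable def iterDiff (h : ℝ) (m : ℕ) (f : ℝ → ℂ) : ℝ → ℂ :=
  (fun g : ℝ → ℂ => fun x => g (x + h) - g x)^[m] f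

/-- The Besov norm `B^σ_{2,q}(ℝ)` via the finite-difference characterization (valid for
`0 < σ < m`). -/
noncomputable def besovDiffNorm (σ : ℝ) (q : ℝ≥0∞) (m : ℕ) (f : ℝ → ℂ) : ℝ≥0∞ :=
  eLpNorm f 2 volume +
    if q = ⊤ then
      ⨆ (h : ℝ) (_ : h ≠ 0), ENNReal.ofReal (|h| ^ (-σ)) * eLpNorm (iterDiff h m f) 2 volume
    else
      (∫⁻ t in Set.Ioo (0 : ℝ) 1,
          (ENNReal.ofReal (t ^ (-σ)) *
            ⨆ (h : ℝ) (_ : |h| ≤ t), eLpNorm (iterDiff h m f) 2 volume) ^ q.toReal /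
            ENNReal.ofReal t) ^ (1 / q.toReal)

/-- Forward difference. -/
noncomputable def fwd (h : ℝ) (g : ℝ → ℂ) : ℝ → ℂ := fun x => g (x + h) - g x

theorem iterDiff_zero' (h : ℝ) (g : ℝ → ℂ) : iterDiff h 0 g = g := rfl

theorem iterDiff_succ' (h : ℝ) (m : ℕ) (g : ℝ → ℂ) :
    iterDiff h (m + 1) g = iterDiff h m (fwd h g) := rfl

theorem iterDiff_succ_out (h : ℝ) (m : ℕ) (g : ℝ → ℂ) :
    iterDiff h (m + 1) g = fwd h (iterDiff h m g) := by
  unfold iterDiff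
  rw [Function.iterate_succ_apply']
  rfl

theorem fwd_continuous {h : ℝ} {g : ℝ → ℂ} (hg : Continuous g) : Continuous (fwd h g) := by
  unfold fwd; fun_prop

theorem eLpNorm_shift {g : ℝ → ℂ} (hg : Continuous g) (h : ℝ) :
    eLpNorm (fun x => g (x + h)) 2 volume = eLpNorm g 2 volume :=
  eLpNorm_comp_measurePreserving (g := g) hg.aestronglyMeasurable
    (measurePreserving_add_right volume h)

theorem eLpNorm_fwd_le {g : ℝ → ℂ} (hg : Continuous g) (h : ℝ) :
    eLpNorm (fwd h g) 2 volume ≤ 2 * eLpNorm g 2 volume := by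
  have h1 : eLpNorm (fwd h g) 2 volume ≤
      eLpNorm (fun x => g (x + h)) 2 volume + eLpNorm g 2 volume :=
    eLpNorm_sub_le (f := fun x => g (x + h)) (g := g)
      (by fun_prop : Continuous fun x => g (x + h)).aestronglyMeasurable
      hg.aestronglyMeasurable (by norm_num)
  rw [eLpNorm_shift hg] at h1
  rwa [two_mul]

theorem eLpNorm_iterDiff_le (m : ℕ) (h : ℝ) : ∀ {g : ℝ → ℂ} (_ : Continuous g),
    eLpNorm (iterDiff h m g) 2 volume ≤ 2 ^ m * eLpNorm g 2 volume := by
  induction m with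
  | zero => intro g hg; simp [iterDiff_zero']
  | succ m ih =>
    intro g hg
    rw [iterDiff_succ']
    refine (ih (fwd_continuous hg)).trans ?_
    rw [pow_succ, mul_assoc]
    gcongr
    exact eLpNorm_fwd_le hg h

theorem enorm_fwd_sq_le {g : ℝ → ℂ} (hg : ContDiff ℝ 1 g) (h x : ℝ) :
    ‖fwd h g x‖ₑ ^ (2 : ℝ) ≤
      ENNReal.ofReal |h| ^ (2 : ℝ) *
        ∫⁻ s in Set.Ioc (0 : ℝ) 1, ‖deriv g (x + s * h)‖ₑ ^ (2 : ℝ) := by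
  have hc : Continuous (deriv g) := hg.continuous_deriv (by norm_num)
  have hd : ∀ y, HasDerivAt g (deriv g y) y := fun y =>
    (hg.differentiable (by norm_num) y).hasDerivAt
  have hcs : Continuous fun s : ℝ => deriv g (x + s * h) := by fun_prop
  have key : fwd h g x = ∫ s in (0:ℝ)..1, h • deriv g (x + s * h) := by
    rw [intervalIntegral.integral_eq_sub_of_hasDerivAt (f := fun s => g (x + s * h))]
    · simp [fwd]
    · intro s _
      have h2 : HasDerivAt (fun s : ℝ => x + s * h) h s := by
        simpa using ((hasDerivAt_id s).mul_const h).const_add x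
      exact (hd (x + s * h)).scomp s h2
    · exact (by fun_prop : Continuous fun s : ℝ => h • deriv g (x + s * h)).intervalIntegrable _ _
  have e1 : ‖fwd h g x‖ₑ ≤ ENNReal.ofReal |h| *
      ∫⁻ s in Set.Ioc (0 : ℝ) 1, ‖deriv g (x + s * h)‖ₑ := by
    rw [key, intervalIntegral.integral_of_le zero_le_one]
    refine (enorm_integral_le_lintegral_enorm _).trans ?_
    rw [← lintegral_const_mul' _ _ ENNReal.ofReal_ne_top]
    apply lintegral_mono
    intro s
    simp only [enorm_smul]
    rw [Real.enorm_eq_ofReal_abs]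
  have : IsProbabilityMeasure (volume.restrict (Set.Ioc (0:ℝ) 1)) := ⟨by simp⟩
  have e2 := eLpNorm_le_eLpNorm_of_exponent_le (μ := volume.restrict (Set.Ioc (0:ℝ) 1))
    (p := 1) (q := 2) (by norm_num) (f := fun s : ℝ => deriv g (x + s * h))
    hcs.aestronglyMeasurable
  rw [eLpNorm_one_eq_lintegral_enorm,
    eLpNorm_eq_lintegral_rpow_enorm_toReal (by norm_num) (by norm_num)] at e2
  have e3 := ENNReal.rpow_le_rpow (e1.trans (mul_le_mul_right e2 _)) (zero_le_two (α := ℝ))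
  rw [ENNReal.mul_rpow_of_nonneg _ _ zero_le_two, ← ENNReal.rpow_mul] at e3
  simpa using e3

theorem eLpNorm_fwd_le_deriv {g : ℝ → ℂ} (hg : ContDiff ℝ 1 g) (h : ℝ) :
    eLpNorm (fwd h g) 2 volume ≤ ENNReal.ofReal |h| * eLpNorm (deriv g) 2 volume := by
  have hc : Continuous (deriv g) := hg.continuous_deriv (by norm_num)
  rw [eLpNorm_eq_lintegral_rpow_enorm_toReal (by norm_num) (by norm_num),
    eLpNorm_eq_lintegral_rpow_enorm_toReal (by norm_num) (by norm_num)]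
  simp only [ENNReal.toReal_ofNat]
  have h1 : ∫⁻ x, ‖fwd h g x‖ₑ ^ (2:ℝ) ≤
      ENNReal.ofReal |h| ^ (2 : ℝ) * ∫⁻ x, ‖deriv g x‖ₑ ^ (2 : ℝ) := by
    calc ∫⁻ x, ‖fwd h g x‖ₑ ^ (2:ℝ) ≤ ∫⁻ x, ENNReal.ofReal |h| ^ (2 : ℝ) *
        ∫⁻ s in Set.Ioc (0 : ℝ) 1, ‖deriv g (x + s * h)‖ₑ ^ (2 : ℝ) :=
          lintegral_mono fun x => enorm_fwd_sq_le hg h x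
      _ = ENNReal.ofReal |h| ^ (2 : ℝ) *
          ∫⁻ x, ∫⁻ s in Set.Ioc (0 : ℝ) 1, ‖deriv g (x + s * h)‖ₑ ^ (2 : ℝ) :=
          lintegral_const_mul' _ _ (by simp)
      _ = ENNReal.ofReal |h| ^ (2 : ℝ) *
          ∫⁻ s in Set.Ioc (0 : ℝ) 1, ∫⁻ x, ‖deriv g (x + s * h)‖ₑ ^ (2 : ℝ) := by
          rw [lintegral_lintegral_swap]
          apply Measurable.aemeasurable
          apply Continuous.measurable
          apply ENNReal.continuous_rpow_const.comp
          apply continuous_enorm.comp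
          fun_prop
      _ = _ := by
          congr 1
          have : ∀ s : ℝ, ∫⁻ x, ‖deriv g (x + s * h)‖ₑ ^ (2 : ℝ) = ∫⁻ x, ‖deriv g x‖ₑ ^ (2 : ℝ) :=
            fun s => lintegral_add_right_eq_self (fun x => ‖deriv g x‖ₑ ^ (2 : ℝ)) (s * h)
          simp only [this]
          simp
  have h2 := ENNReal.rpow_le_rpow h1 (by norm_num : (0:ℝ) ≤ 1 / 2)
  refine h2.trans ?_
  rw [ENNReal.mul_rpow_of_nonneg _ _ (by norm_num), ← ENNReal.rpow_mul]
  simp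

theorem iteratedDeriv_fwd {g : ℝ → ℂ} (m : ℕ) (hg : ContDiff ℝ m g) (h : ℝ) :
    iteratedDeriv m (fwd h g) = fwd h (iteratedDeriv m g) := by
  ext x
  unfold fwd
  have hs : ContDiff ℝ m (fun x => g (x + h)) := hg.comp (contDiff_id.add contDiff_const)
  rw [iteratedDeriv_fun_sub hs.contDiffAt hg.contDiffAt, iteratedDeriv_comp_add_const]

theorem eLpNorm_iterDiff_le_deriv (m : ℕ) (h : ℝ) : ∀ {g : ℝ → ℂ} (_ : ContDiff ℝ m g),
    eLpNorm (iterDiff h m g) 2 volume ≤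
      ENNReal.ofReal |h| ^ m * eLpNorm (iteratedDeriv m g) 2 volume := by
  induction m with
  | zero => intro g hg; simp [iterDiff_zero']
  | succ m ih =>
    intro g hg
    have hg' : ContDiff ℝ m g := hg.of_le (by norm_cast; omega)
    have hf : ContDiff ℝ m (fwd h g) :=
      (hg'.comp (contDiff_id.add contDiff_const)).sub hg'
    rw [iterDiff_succ']
    refine (ih hf).trans ?_
    rw [iteratedDeriv_fwd m hg', pow_succ, mul_assoc]
    gcongr
    rw [iteratedDeriv_succ]
    apply eLpNorm_fwd_le_deriv
    rw [iteratedDeriv_eq_iterate]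
    exact ContDiff.iterate_deriv' 1 m (by rwa [add_comm])

theorem eLpNorm_dilate {g : ℝ → ℂ} (hg : Continuous g) {L : ℝ} (hL : 0 < L) :
    eLpNorm (fun x => g (x / L)) 2 volume =
      ENNReal.ofReal (L ^ (1 / 2 : ℝ)) * eLpNorm g 2 volume := by
  have h1 := Real.map_volume_mul_left (inv_ne_zero hL.ne')
  have h2 := eLpNorm_map_measure (p := 2) (μ := volume) (g := g) (f := fun x => L⁻¹ * x)
    hg.aestronglyMeasurable (by fun_prop)
  rw [h1, eLpNorm_smul_measure_of_ne_top (by norm_num)] at h2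
  have h3 : (g ∘ fun x => L⁻¹ * x) = fun x => g (x / L) := by
    ext x; simp [div_eq_inv_mul]
  rw [h3] at h2
  rw [← h2, inv_inv, abs_of_pos hL, smul_eq_mul, ENNReal.ofReal_rpow_of_pos hL]
  simp

/-- The modulated dilation. -/
noncomputable def modf (f : SchwartzMap ℝ ℂ) (L lam a : ℝ) : ℝ → ℂ :=
  fun x => f (x / L) * (Real.cos (lam * x - a) : ℂ)

theorem dil_contDiff (f : SchwartzMap ℝ ℂ) (L : ℝ) (n : ℕ) :
    ContDiff ℝ n (fun x => f (x / L)) :=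
  (f.smooth n).comp (contDiff_id.div_const L)

theorem modf_contDiff (f : SchwartzMap ℝ ℂ) (L lam a : ℝ) (n : ℕ) :
    ContDiff ℝ n (modf f L lam a) := by
  unfold modf
  refine (dil_contDiff f L n).mul ?_
  refine Complex.ofRealCLM.contDiff.comp ?_
  exact Real.contDiff_cos.comp ((contDiff_const.mul contDiff_id).sub contDiff_const)

theorem dil_hasDerivAt (f : SchwartzMap ℝ ℂ) (L x : ℝ) :
    HasDerivAt (fun x => f (x / L)) ((L⁻¹ : ℂ) * SchwartzMap.derivCLM ℂ ℂ f (x / L)) x := by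
  have h1 : HasDerivAt f (deriv f (x / L)) (x / L) :=
    ((f.smooth 1).differentiable (by norm_num) _).hasDerivAt
  have h2 : HasDerivAt (fun x : ℝ => x / L) (1 / L) x := (hasDerivAt_id x).div_const L
  have h3 : HasDerivAt (fun x => f (x / L)) ((1 / L) • deriv f (x / L)) x := h1.scomp x h2
  have e : (1 / L) • deriv f (x / L) =
      (L⁻¹ : ℂ) * SchwartzMap.derivCLM ℂ ℂ f (x / L) := by
    rw [SchwartzMap.derivCLM_apply, Complex.real_smul]
    push_cast
    ring
  rwa [e] at h3

theorem modf_deriv (f : SchwartzMap ℝ ℂ) (L lam a : ℝ) :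
    deriv (modf f L lam a) = fun x => (L⁻¹ : ℂ) * modf (SchwartzMap.derivCLM ℂ ℂ f) L lam a x +
      (lam : ℂ) * modf f L lam (a - Real.pi / 2) x := by
  ext x
  have h2 : HasDerivAt (fun x : ℝ => lam * x - a) lam x := by
    simpa using ((hasDerivAt_id x).const_mul lam).sub_const a
  have h3 := (h2.cos).ofReal_comp
  have h4 := (dil_hasDerivAt f L x).mul h3
  have h5 : HasDerivAt (modf f L lam a) _ x := h4
  rw [h5.deriv]
  unfold modf
  have : Real.cos (lam * x - (a - Real.pi / 2)) = - Real.sin (lam * x - a) := by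
    rw [← Real.cos_add_pi_div_two]; congr 1; ring
  rw [this]
  push_cast
  ring

theorem modf_eLpNorm_le (f : SchwartzMap ℝ ℂ) {L : ℝ} (hL : 0 < L) (lam a : ℝ) :
    eLpNorm (modf f L lam a) 2 volume ≤
      ENNReal.ofReal (L ^ (1 / 2 : ℝ)) * eLpNorm f 2 volume := by
  rw [← eLpNorm_dilate f.continuous hL]
  apply eLpNorm_mono
  intro x
  unfold modf
  rw [norm_mul, Complex.norm_real]
  exact mul_le_of_le_one_right (norm_nonneg _) (Real.abs_cos_le_one _)

theorem modf_iteratedDeriv (m : ℕ) : ∀ f : SchwartzMap ℝ ℂ, ∃ K : ℝ, 0 ≤ K ∧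
    ∀ L : ℝ, 1 ≤ L → ∀ lam : ℝ, 1 ≤ lam → ∀ a : ℝ,
      eLpNorm (iteratedDeriv m (modf f L lam a)) 2 volume ≤
        ENNReal.ofReal (K * lam ^ m * L ^ (1 / 2 : ℝ)) := by
  induction m with
  | zero =>
    intro f
    refine ⟨(eLpNorm f 2 volume).toReal, ENNReal.toReal_nonneg, fun L hL lam hlam a => ?_⟩
    rw [iteratedDeriv_zero]
    refine (modf_eLpNorm_le f (by linarith) lam a).trans ?_
    rw [pow_zero, mul_one, ENNReal.ofReal_mul ENNReal.toReal_nonneg,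
      ENNReal.ofReal_toReal (f.memLp 2 volume).2.ne, mul_comm]
  | succ m ih =>
    intro f
    obtain ⟨K1, hK1, h1⟩ := ih f
    obtain ⟨K2, hK2, h2⟩ := ih (SchwartzMap.derivCLM ℂ ℂ f)
    refine ⟨K2 + K1, by positivity, fun L hL lam hlam a => ?_⟩
    have hL0 : 0 < L := by linarith
    have hl0 : 0 < lam := by linarith
    have e : iteratedDeriv (m + 1) (modf f L lam a) =
        ((L⁻¹ : ℝ) : ℂ) • iteratedDeriv m (modf (SchwartzMap.derivCLM ℂ ℂ f) L lam a) +
        (lam : ℂ) • iteratedDeriv m (modf f L lam (a - Real.pi / 2)) := by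
      rw [iteratedDeriv_succ', modf_deriv]
      ext x
      rw [iteratedDeriv_fun_add (contDiff_const.mul (modf_contDiff _ _ _ _ m)).contDiffAt
        (contDiff_const.mul (modf_contDiff _ _ _ _ m)).contDiffAt,
        iteratedDeriv_const_mul_field, iteratedDeriv_const_mul_field]
      simp
    have hc : ∀ f a, AEStronglyMeasurable (iteratedDeriv m (modf f L lam a)) volume := fun f a =>
      ((modf_contDiff f L lam a m).continuous_iteratedDeriv m le_rfl).aestronglyMeasurable
    rw [e]
    refine (eLpNorm_add_le ((hc _ _).const_smul _) ((hc _ _).const_smul _) (by norm_num)).trans ?_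
    rw [eLpNorm_const_smul, eLpNorm_const_smul]
    have e1 : ‖((L⁻¹ : ℝ) : ℂ)‖ₑ ≤ ENNReal.ofReal lam := by
      rw [← ofReal_norm, Complex.norm_real, Real.norm_of_nonneg (by positivity)]
      exact ENNReal.ofReal_le_ofReal ((inv_le_one_of_one_le₀ hL).trans hlam)
    have e2 : ‖(lam : ℂ)‖ₑ = ENNReal.ofReal lam := by
      rw [← ofReal_norm, Complex.norm_real, Real.norm_of_nonneg (by positivity)]
    rw [e2]
    refine (add_le_add (mul_le_mul' e1 (h2 L hL lam hlam a))
      (mul_le_mul' le_rfl (h1 L hL lam hlam (a - Real.pi / 2)))).trans ?_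
    rw [← ENNReal.ofReal_mul hl0.le, ← ENNReal.ofReal_mul hl0.le,
      ← ENNReal.ofReal_add (by positivity) (by positivity)]
    apply le_of_eq
    congr 1
    ring

theorem dil_fwd_le (f : SchwartzMap ℝ ℂ) {L : ℝ} (hL : 1 ≤ L) (h : ℝ) :
    eLpNorm (fwd h (fun x => f (x / L))) 2 volume ≤ ENNReal.ofReal |h| *
      (ENNReal.ofReal (L ^ (1 / 2 : ℝ)) * eLpNorm (SchwartzMap.derivCLM ℂ ℂ f) 2 volume) := by
  refine (eLpNorm_fwd_le_deriv (dil_contDiff f L 1) h).trans ?_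
  gcongr
  rw [← eLpNorm_dilate (SchwartzMap.continuous _) (by linarith)]
  apply eLpNorm_mono
  intro x
  rw [(dil_hasDerivAt f L x).deriv, norm_mul]
  apply mul_le_of_le_one_left (norm_nonneg _)
  rw [norm_inv, Complex.norm_real, Real.norm_of_nonneg (by linarith)]
  exact inv_le_one_of_one_le₀ hL

theorem low_one (f : SchwartzMap ℝ ℂ) (L a : ℝ) {lam : ℝ} (hl : 0 < lam) :
    eLpNorm (fun x => f (x / L)) 2 volume ≤ 2 * eLpNorm (modf f L lam a) 2 volume +
      eLpNorm (fwd (Real.pi / (2 * lam)) (fun x => f (x / L))) 2 volume := by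
  set h := Real.pi / (2 * lam) with hh
  set u : ℝ → ℂ := fun x => f (x / L) with hu
  set g := modf f L lam a with hgd
  have hg : Continuous g := (modf_contDiff f L lam a 0).continuous
  have huc : Continuous u := (dil_contDiff f L 0).continuous
  have hpt : ∀ x, ‖u x‖ ≤ ‖‖g x‖ + ‖g (x + h)‖ + ‖fwd h u x‖‖ := by
    intro x
    rw [Real.norm_of_nonneg (by positivity)]
    have hc : Real.cos (lam * (x + h) - a) = - Real.sin (lam * x - a) := by
      rw [← Real.cos_add_pi_div_two]; congr 1; rw [hh]; field_simp; ring
    have e : u x = (Real.cos (lam * x - a) : ℂ) * g x + (Real.sin (lam * x - a) : ℂ) *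
        (- g (x + h)) + (Real.sin (lam * x - a) : ℂ) * (- (Real.sin (lam * x - a) : ℂ) * fwd h u x) := by
      have g1 : g x = u x * (Real.cos (lam * x - a) : ℂ) := rfl
      have g2 : g (x + h) = u (x + h) * (Real.cos (lam * (x + h) - a) : ℂ) := rfl
      rw [g1, g2, hc]
      have hs : (Real.sin (lam * x - a) : ℂ) ^ 2 + (Real.cos (lam * x - a) : ℂ) ^ 2 = 1 := by
        exact_mod_cast Real.sin_sq_add_cos_sq _
      unfold fwd
      push_cast at hs ⊢
      linear_combination (-u x) * hs
    have n1 : ‖(Real.cos (lam * x - a) : ℂ)‖ ≤ 1 := by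
      rw [Complex.norm_real]; exact Real.abs_cos_le_one _
    have n2 : ‖(Real.sin (lam * x - a) : ℂ)‖ ≤ 1 := by
      rw [Complex.norm_real]; exact Real.abs_sin_le_one _
    have n3 := congrArg norm e
    rw [n3]
    refine norm_add₃_le.trans ?_
    simp only [norm_mul, norm_neg]
    gcongr
    · exact mul_le_of_le_one_left (norm_nonneg _) n1
    · exact mul_le_of_le_one_left (norm_nonneg _) n2
    · rw [← mul_assoc]
      exact mul_le_of_le_one_left (norm_nonneg _) (mul_le_one₀ n2 (norm_nonneg _) n2)
  have m1 : AEStronglyMeasurable (fun x => ‖g x‖) volume := hg.norm.aestronglyMeasurable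
  have m2 : AEStronglyMeasurable (fun x => ‖g (x + h)‖) volume :=
    (by fun_prop : Continuous fun x => ‖g (x + h)‖).aestronglyMeasurable
  have m3 : AEStronglyMeasurable (fun x => ‖fwd h u x‖) volume :=
    (fwd_continuous huc).norm.aestronglyMeasurable
  refine (eLpNorm_mono hpt).trans ?_
  refine (eLpNorm_add_le (m1.add m2) m3 (by norm_num)).trans ?_
  rw [eLpNorm_norm]
  gcongr
  refine (eLpNorm_add_le m1 m2 (by norm_num)).trans ?_
  rw [eLpNorm_norm, eLpNorm_norm (fun x => g (x + h)), eLpNorm_shift hg, two_mul]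

theorem low_iter (m : ℕ) (h : ℝ) : ∀ {g : ℝ → ℂ} (_ : Continuous g),
    eLpNorm g 2 volume ≤ eLpNorm (iterDiff h m g) 2 volume +
      4 ^ m * eLpNorm (fun x => g (x + h) + g x) 2 volume := by
  induction m with
  | zero => intro g hg; rw [iterDiff_zero']; exact le_self_add
  | succ m ih =>
    intro g hg
    have hS : Continuous (fun x => g (x + h) + g x) := by fun_prop
    have h1 : eLpNorm g 2 volume ≤ eLpNorm (fwd h g) 2 volume +
        eLpNorm (fun x => g (x + h) + g x) 2 volume := by
      have hpt : ∀ x, ‖g x‖ ≤ ‖‖fwd h g x‖ + ‖g (x + h) + g x‖‖ := by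
        intro x
        rw [Real.norm_of_nonneg (by positivity)]
        have e : (2 : ℂ) * g x = (g (x + h) + g x) - fwd h g x := by unfold fwd; ring
        have h2 := norm_sub_le (g (x + h) + g x) (fwd h g x)
        rw [← e, norm_mul] at h2
        have h3 : ‖(2 : ℂ)‖ = 2 := by simp
        rw [h3] at h2
        linarith [norm_nonneg (g x)]
      refine (eLpNorm_mono hpt).trans ?_
      refine (eLpNorm_add_le (fwd_continuous hg).norm.aestronglyMeasurable
        hS.norm.aestronglyMeasurable (by norm_num)).trans ?_
      rw [eLpNorm_norm, eLpNorm_norm (fun x => g (x + h) + g x)]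
    have h2 := ih (fwd_continuous (h := h) hg)
    have e : (fun x => fwd h g (x + h) + fwd h g x) = fwd h (fun x => g (x + h) + g x) := by
      ext x; unfold fwd; ring
    rw [e] at h2
    have h3 := eLpNorm_fwd_le hS h
    rw [iterDiff_succ']
    calc _ ≤ _ := h1
      _ ≤ (eLpNorm (iterDiff h m (fwd h g)) 2 volume +
          4 ^ m * (2 * eLpNorm (fun x => g (x + h) + g x) 2 volume)) +
          4 ^ m * eLpNorm (fun x => g (x + h) + g x) 2 volume := by
          refine add_le_add (h2.trans (by gcongr)) ?_
          exact le_mul_of_one_le_left zero_le (one_le_pow₀ (by norm_num))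
      _ = eLpNorm (iterDiff h m (fwd h g)) 2 volume +
          4 ^ m * 3 * eLpNorm (fun x => g (x + h) + g x) 2 volume := by ring
      _ ≤ _ := by
          rw [pow_succ]
          gcongr
          norm_num

theorem low_two (f : SchwartzMap ℝ ℂ) (L a : ℝ) {lam : ℝ} (hl : 0 < lam) :
    eLpNorm (fun x => modf f L lam a (x + Real.pi / lam) + modf f L lam a x) 2 volume ≤
      eLpNorm (fwd (Real.pi / lam) (fun x => f (x / L))) 2 volume := by
  apply eLpNorm_mono
  intro x
  have hc : Real.cos (lam * (x + Real.pi / lam) - a) = - Real.cos (lam * x - a) := by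
    rw [← Real.cos_add_pi]; congr 1; field_simp; ring
  have e : modf f L lam a (x + Real.pi / lam) + modf f L lam a x =
      (- Real.cos (lam * x - a) : ℂ) * fwd (Real.pi / lam) (fun x => f (x / L)) x := by
    unfold modf fwd
    rw [hc]; push_cast; ring
  rw [e, norm_mul]
  refine mul_le_of_le_one_left (norm_nonneg _) ?_
  rw [norm_neg, Complex.norm_real]; exact Real.abs_cos_le_one _

theorem lint_Ioc {c r : ℝ} (hc : 0 < c) (hr : -1 < r) :
    ∫⁻ t in Set.Ioc 0 c, ENNReal.ofReal (t ^ r) = ENNReal.ofReal (c ^ (r + 1) / (r + 1)) := by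
  have hi : IntegrableOn (fun t : ℝ => t ^ r) (Set.Ioc 0 c) :=
    (intervalIntegrable_iff_integrableOn_Ioc_of_le hc.le).1
      (intervalIntegral.intervalIntegrable_rpow' hr)
  rw [← ofReal_integral_eq_lintegral_ofReal hi]
  · rw [← intervalIntegral.integral_of_le hc.le, integral_rpow (Or.inl hr),
      Real.zero_rpow (by linarith), sub_zero]
  · refine (ae_restrict_iff' measurableSet_Ioc).2 (Filter.Eventually.of_forall fun t ht => ?_)
    exact Real.rpow_nonneg ht.1.le _

theorem lint_Ioi {c r : ℝ} (hc : 0 < c) (hr : r < -1) :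
    ∫⁻ t in Set.Ioi c, ENNReal.ofReal (t ^ r) = ENNReal.ofReal (-c ^ (r + 1) / (r + 1)) := by
  rw [← ofReal_integral_eq_lintegral_ofReal (integrableOn_Ioi_rpow_of_lt hr hc)]
  · rw [integral_Ioi_rpow_of_lt hr hc]
  · refine (ae_restrict_iff' measurableSet_Ioi).2 (Filter.Eventually.of_forall fun t ht => ?_)
    exact Real.rpow_nonneg (hc.trans ht).le _

theorem upper_top {σ : ℝ} (hσ : 0 < σ) {m : ℕ} (hm : σ < m) (g : ℝ → ℂ) {A lam : ℝ}
    (hA : 0 ≤ A) (hl : 1 ≤ lam)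
    (h1 : ∀ h, eLpNorm (iterDiff h m g) 2 volume ≤ ENNReal.ofReal A)
    (h2 : ∀ h, eLpNorm (iterDiff h m g) 2 volume ≤ ENNReal.ofReal (A * (lam * |h|) ^ m)) :
    ⨆ (h : ℝ) (_ : h ≠ 0), ENNReal.ofReal (|h| ^ (-σ)) * eLpNorm (iterDiff h m g) 2 volume ≤
      ENNReal.ofReal (A * lam ^ σ) := by
  refine iSup₂_le fun h hh => ?_
  have hl0 : 0 < lam := by linarith
  have ha : 0 < |h| := abs_pos.2 hh
  have hs : 0 < lam * |h| := by positivity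
  have e : |h| ^ (-σ) = lam ^ σ * (lam * |h|) ^ (-σ) := by
    rw [Real.mul_rpow hl0.le ha.le, ← mul_assoc, ← Real.rpow_add hl0]; simp
  rcases le_total (lam * |h|) 1 with hc | hc
  · refine (mul_le_mul' le_rfl (h2 h)).trans ?_
    rw [← ENNReal.ofReal_mul (by positivity)]
    apply ENNReal.ofReal_le_ofReal
    rw [e]
    have : (lam * |h|) ^ (-σ) * (lam * |h|) ^ m ≤ 1 := by
      rw [← Real.rpow_natCast, ← Real.rpow_add hs]
      exact Real.rpow_le_one hs.le hc (by linarith)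
    calc _ = A * lam ^ σ * ((lam * |h|) ^ (-σ) * (lam * |h|) ^ m) := by ring
      _ ≤ _ := mul_le_of_le_one_right (by positivity) this
  · refine (mul_le_mul' le_rfl (h1 h)).trans ?_
    rw [← ENNReal.ofReal_mul (by positivity)]
    apply ENNReal.ofReal_le_ofReal
    rw [e]
    have : (lam * |h|) ^ (-σ) ≤ 1 := Real.rpow_le_one_of_one_le_of_nonpos hc (by linarith)
    calc _ = A * lam ^ σ * ((lam * |h|) ^ (-σ)) := by ring
      _ ≤ _ := mul_le_of_le_one_right (by positivity) this

theorem upper_fin {σ : ℝ} (hσ : 0 < σ) {m : ℕ} (hm : σ < m) {p : ℝ} (hp : 2 ≤ p) (g : ℝ → ℂ)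
    {A lam : ℝ} (hA : 0 ≤ A) (hl : 1 ≤ lam)
    (h1 : ∀ h, eLpNorm (iterDiff h m g) 2 volume ≤ ENNReal.ofReal A)
    (h2 : ∀ h, eLpNorm (iterDiff h m g) 2 volume ≤ ENNReal.ofReal (A * (lam * |h|) ^ m)) :
    (∫⁻ t in Set.Ioo (0 : ℝ) 1,
          (ENNReal.ofReal (t ^ (-σ)) *
            ⨆ (h : ℝ) (_ : |h| ≤ t), eLpNorm (iterDiff h m g) 2 volume) ^ p /
            ENNReal.ofReal t) ^ (1 / p) ≤
      ENNReal.ofReal ((1 / ((m - σ) * p) + 1 / (σ * p)) ^ (1 / p) * A * lam ^ σ) := by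
  have hl0 : 0 < lam := by linarith
  have hp0 : 0 < p := by linarith
  have hms : 0 < (m - σ) := by linarith
  set I : ℝ → ℝ≥0∞ := fun t => (ENNReal.ofReal (t ^ (-σ)) *
            ⨆ (h : ℝ) (_ : |h| ≤ t), eLpNorm (iterDiff h m g) 2 volume) ^ p /
            ENNReal.ofReal t with hI
  have b1 : ∀ t, 0 < t → I t ≤ ENNReal.ofReal (A ^ p) * ENNReal.ofReal (t ^ (-σ * p - 1)) := by
    intro t ht
    have : (⨆ (h : ℝ) (_ : |h| ≤ t), eLpNorm (iterDiff h m g) 2 volume) ≤ ENNReal.ofReal A :=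
      iSup₂_le fun h _ => h1 h
    calc I t ≤ (ENNReal.ofReal (t ^ (-σ)) * ENNReal.ofReal A) ^ p / ENNReal.ofReal t := by
          simp only [hI]; gcongr
      _ = ENNReal.ofReal (((t ^ (-σ)) * A) ^ p / t) := by
          rw [← ENNReal.ofReal_mul (by positivity), ENNReal.ofReal_rpow_of_nonneg (by positivity) hp0.le,
            ENNReal.ofReal_div_of_pos ht]
      _ = _ := by
          rw [← ENNReal.ofReal_mul (by positivity), Real.mul_rpow (by positivity) hA,
            ← Real.rpow_mul ht.le, Real.rpow_sub_one ht.ne']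
          congr 1; ring
  have b2 : ∀ t, 0 < t → I t ≤ ENNReal.ofReal (A ^ p * lam ^ (m * p)) *
      ENNReal.ofReal (t ^ ((m - σ) * p - 1)) := by
    intro t ht
    have : (⨆ (h : ℝ) (_ : |h| ≤ t), eLpNorm (iterDiff h m g) 2 volume) ≤
        ENNReal.ofReal (A * (lam * t) ^ m) :=
      iSup₂_le fun h hh => (h2 h).trans (ENNReal.ofReal_le_ofReal (by gcongr))
    calc I t ≤ (ENNReal.ofReal (t ^ (-σ)) * ENNReal.ofReal (A * (lam * t) ^ m)) ^ p /
          ENNReal.ofReal t := by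
          simp only [hI]; gcongr
      _ = ENNReal.ofReal (((t ^ (-σ)) * (A * (lam * t) ^ m)) ^ p / t) := by
          rw [← ENNReal.ofReal_mul (by positivity), ENNReal.ofReal_rpow_of_nonneg (by positivity) hp0.le,
            ENNReal.ofReal_div_of_pos ht]
      _ = _ := by
          rw [← ENNReal.ofReal_mul (by positivity), Real.rpow_sub_one ht.ne']
          congr 1
          have : t ^ (-σ) * (A * (lam * t) ^ m) = A * lam ^ (m : ℝ) * t ^ (m - σ) := by
            rw [sub_eq_neg_add, Real.rpow_add ht, Real.rpow_natCast, Real.rpow_natCast]; ring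
          rw [this, Real.mul_rpow (by positivity) (by positivity), Real.mul_rpow hA (by positivity),
            ← Real.rpow_mul ht.le, ← Real.rpow_mul hl0.le]
          ring
  have hc : 0 < lam⁻¹ := by positivity
  have i1 : ∫⁻ t in Set.Ioc 0 lam⁻¹, I t ≤
      ENNReal.ofReal (A ^ p * lam ^ (σ * p) * (1 / ((m - σ) * p))) := by
    calc _ ≤ ∫⁻ t in Set.Ioc 0 lam⁻¹, ENNReal.ofReal (A ^ p * lam ^ (m * p)) *
        ENNReal.ofReal (t ^ ((m - σ) * p - 1)) :=
          setLIntegral_mono' measurableSet_Ioc fun t ht => b2 t ht.1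
      _ = _ := by
        have hr : 0 < (m - σ) * p := by positivity
        rw [lintegral_const_mul' _ _ ENNReal.ofReal_ne_top, lint_Ioc hc (by linarith),
          ← ENNReal.ofReal_mul (by positivity), sub_add_cancel, Real.inv_rpow hl0.le]
        congr 1
        have : lam ^ (m * p) = lam ^ (σ * p) * lam ^ ((m - σ) * p) := by
          rw [← Real.rpow_add hl0]; congr 1; ring
        rw [this]
        have : 0 < lam ^ ((m - σ) * p) := by positivity
        field_simp
  have i2 : ∫⁻ t in Set.Ioi lam⁻¹, I t ≤
      ENNReal.ofReal (A ^ p * lam ^ (σ * p) * (1 / (σ * p))) := by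
    calc _ ≤ ∫⁻ t in Set.Ioi lam⁻¹, ENNReal.ofReal (A ^ p) *
        ENNReal.ofReal (t ^ (-σ * p - 1)) :=
          setLIntegral_mono' measurableSet_Ioi fun t ht => b1 t (hc.trans ht)
      _ = _ := by
        have hr : 0 < σ * p := by positivity
        rw [lintegral_const_mul' _ _ ENNReal.ofReal_ne_top, lint_Ioi hc (by linarith),
          ← ENNReal.ofReal_mul (by positivity), sub_add_cancel, Real.inv_rpow hl0.le,
          neg_mul, Real.rpow_neg hl0.le, inv_inv, neg_div_neg_eq]
        congr 1
        ring
  have i3 : ∫⁻ t in Set.Ioo (0 : ℝ) 1, I t ≤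
      ENNReal.ofReal (A ^ p * lam ^ (σ * p) * (1 / ((m - σ) * p) + 1 / (σ * p))) := by
    calc _ ≤ ∫⁻ t in Set.Ioc 0 lam⁻¹ ∪ Set.Ioi lam⁻¹, I t := by
          apply lintegral_mono_set
          intro t ht
          rcases le_or_gt t lam⁻¹ with h | h
          · exact Or.inl ⟨ht.1, h⟩
          · exact Or.inr h
      _ ≤ _ := lintegral_union_le _ _ _
      _ ≤ _ := add_le_add i1 i2
      _ = _ := by
        rw [← ENNReal.ofReal_add (by positivity) (by positivity), mul_add]
  refine (ENNReal.rpow_le_rpow i3 (by positivity)).trans (le_of_eq ?_)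
  rw [ENNReal.ofReal_rpow_of_nonneg (by positivity) (by positivity)]
  congr 1
  rw [Real.mul_rpow (by positivity) (by positivity), Real.mul_rpow (by positivity) (by positivity),
    ← Real.rpow_mul hA, ← Real.rpow_mul hl0.le, mul_one_div_cancel hp0.ne', Real.rpow_one,
    mul_assoc σ, mul_one_div_cancel hp0.ne', mul_one]
  ring

theorem upper_besov {σ : ℝ} (hσ : 0 < σ) {m : ℕ} (hm : σ < m) {q : ℝ≥0∞} (hq : 2 ≤ q) :
    ∃ C0 : ℝ, 0 < C0 ∧ ∀ (g : ℝ → ℂ) (A lam : ℝ), 0 ≤ A → 1 ≤ lam →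
      eLpNorm g 2 volume ≤ ENNReal.ofReal A →
      (∀ h, eLpNorm (iterDiff h m g) 2 volume ≤ ENNReal.ofReal A) →
      (∀ h, eLpNorm (iterDiff h m g) 2 volume ≤ ENNReal.ofReal (A * (lam * |h|) ^ m)) →
      besovDiffNorm σ q m g ≤ ENNReal.ofReal (C0 * A * lam ^ σ) := by
  have key : ∃ C1 : ℝ, 0 ≤ C1 ∧ ∀ (g : ℝ → ℂ) (A lam : ℝ), 0 ≤ A → 1 ≤ lam →
      (∀ h, eLpNorm (iterDiff h m g) 2 volume ≤ ENNReal.ofReal A) →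
      (∀ h, eLpNorm (iterDiff h m g) 2 volume ≤ ENNReal.ofReal (A * (lam * |h|) ^ m)) →
      besovDiffNorm σ q m g ≤ eLpNorm g 2 volume + ENNReal.ofReal (C1 * A * lam ^ σ) := by
    by_cases hqt : q = ⊤
    · refine ⟨1, zero_le_one, fun g A lam hA hl h1 h2 => ?_⟩
      unfold besovDiffNorm
      rw [if_pos hqt, one_mul]
      gcongr
      exact upper_top hσ hm g hA hl h1 h2
    · have hp : 2 ≤ q.toReal := by
        simpa using (ENNReal.toReal_le_toReal (by norm_num) hqt).2 hq
      have hms : 0 < (m - σ) := by linarith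
      refine ⟨(1 / ((m - σ) * q.toReal) + 1 / (σ * q.toReal)) ^ (1 / q.toReal), by positivity,
        fun g A lam hA hl h1 h2 => ?_⟩
      unfold besovDiffNorm
      rw [if_neg hqt]
      gcongr
      exact upper_fin hσ hm hp g hA hl h1 h2
  obtain ⟨C1, hC1, H⟩ := key
  refine ⟨1 + C1, by positivity, fun g A lam hA hl h0 h1 h2 => ?_⟩
  refine (H g A lam hA hl h1 h2).trans ?_
  have hs : 1 ≤ lam ^ σ := Real.one_le_rpow hl hσ.le
  refine (add_le_add_left h0 _).trans ?_
  rw [← ENNReal.ofReal_add hA (by positivity)]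
  apply ENNReal.ofReal_le_ofReal
  nlinarith [mul_le_mul_of_nonneg_left hs hA]

theorem lower_besov {σ : ℝ} (hσ : 0 < σ) {m : ℕ} {q : ℝ≥0∞} (hq : 2 ≤ q) (g : ℝ → ℂ)
    {B lam : ℝ} (hB : 0 ≤ B) (hl : 2 * Real.pi < lam)
    (h1 : ENNReal.ofReal B ≤ eLpNorm (iterDiff (Real.pi / lam) m g) 2 volume) :
    ENNReal.ofReal ((2 * Real.pi) ^ (-σ) / 2 * B * lam ^ σ) ≤ besovDiffNorm σ q m g := by
  have hpi := Real.pi_pos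
  have hl0 : 0 < lam := by linarith
  have hh : 0 < Real.pi / lam := by positivity
  have e : (2 * Real.pi / lam) ^ (-σ) = (2 * Real.pi) ^ (-σ) * lam ^ σ := by
    rw [Real.div_rpow (by positivity) hl0.le, Real.rpow_neg hl0.le]
    simp
  have hX : (2 * Real.pi) ^ (-σ) / 2 * B * lam ^ σ = (2 * Real.pi / lam) ^ (-σ) * B / 2 := by
    rw [e]; ring
  rw [hX]
  set X := (2 * Real.pi / lam) ^ (-σ) * B with hXd
  have hX0 : 0 ≤ X := by positivity
  have hle : ∀ t : ℝ, 0 < t → t ≤ 2 * Real.pi / lam →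
      ENNReal.ofReal X ≤ ENNReal.ofReal (t ^ (-σ)) *
        eLpNorm (iterDiff (Real.pi / lam) m g) 2 volume := by
    intro t ht htl
    rw [hXd, ENNReal.ofReal_mul (by positivity)]
    refine mul_le_mul' (ENNReal.ofReal_le_ofReal ?_) h1
    exact Real.rpow_le_rpow_of_nonpos ht htl (by linarith)
  have hpl : Real.pi / lam ≤ 2 * Real.pi / lam := by gcongr; linarith
  unfold besovDiffNorm
  refine le_trans ?_ le_add_self
  by_cases hqt : q = ⊤
  · rw [if_pos hqt]
    refine le_trans ?_ (le_iSup₂ (f := fun (h : ℝ) (_ : h ≠ 0) =>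
      ENNReal.ofReal (|h| ^ (-σ)) * eLpNorm (iterDiff h m g) 2 volume) (Real.pi / lam) hh.ne')
    simp only [abs_of_pos hh]
    exact (ENNReal.ofReal_le_ofReal (by linarith)).trans (hle _ hh hpl)
  · rw [if_neg hqt]
    have hp : 2 ≤ q.toReal := by
      simpa using (ENNReal.toReal_le_toReal (by norm_num) hqt).2 hq
    set p := q.toReal
    have hp0 : 0 < p := by linarith
    have hlt : 2 * Real.pi / lam < 1 := by rwa [div_lt_one hl0]
    have hi : ENNReal.ofReal ((X / 2) ^ p) ≤ ∫⁻ t in Set.Ioo (0 : ℝ) 1,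
          (ENNReal.ofReal (t ^ (-σ)) *
            ⨆ (h : ℝ) (_ : |h| ≤ t), eLpNorm (iterDiff h m g) 2 volume) ^ p /
            ENNReal.ofReal t := by
      calc ENNReal.ofReal ((X / 2) ^ p)
          ≤ ENNReal.ofReal (X ^ p / (2 * Real.pi / lam) * (Real.pi / lam)) := by
            apply ENNReal.ofReal_le_ofReal
            rw [Real.div_rpow hX0 (by norm_num)]
            have h2p : (2 : ℝ) ≤ 2 ^ p := by
              simpa using Real.rpow_le_rpow_of_exponent_le (one_le_two (α := ℝ))
                (by linarith : (1 : ℝ) ≤ p)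
            have : X ^ p / (2 * Real.pi / lam) * (Real.pi / lam) = X ^ p / 2 := by
              field_simp
            rw [this]
            gcongr
        _ = ∫⁻ t in Set.Ioc (Real.pi / lam) (2 * Real.pi / lam),
              (ENNReal.ofReal X) ^ p / ENNReal.ofReal (2 * Real.pi / lam) := by
            rw [setLIntegral_const, Real.volume_Ioc,
              ENNReal.ofReal_rpow_of_nonneg hX0 hp0.le,
              ← ENNReal.ofReal_div_of_pos (by positivity), ← ENNReal.ofReal_mul (by positivity)]
            congr 2
            ring
        _ ≤ ∫⁻ t in Set.Ioc (Real.pi / lam) (2 * Real.pi / lam),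
              (ENNReal.ofReal (t ^ (-σ)) *
            ⨆ (h : ℝ) (_ : |h| ≤ t), eLpNorm (iterDiff h m g) 2 volume) ^ p /
            ENNReal.ofReal t := by
            refine setLIntegral_mono' measurableSet_Ioc fun t ht => ?_
            have ht0 : 0 < t := hh.trans ht.1
            refine ENNReal.div_le_div (ENNReal.rpow_le_rpow ?_ hp0.le)
              (ENNReal.ofReal_le_ofReal ht.2)
            refine (hle t ht0 ht.2).trans (mul_le_mul' le_rfl ?_)
            exact le_iSup₂ (f := fun (h : ℝ) (_ : |h| ≤ t) =>
              eLpNorm (iterDiff h m g) 2 volume) (Real.pi / lam)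
              (by rw [abs_of_pos hh]; exact ht.1.le)
        _ ≤ _ := by
            apply lintegral_mono_set
            intro t ht
            exact ⟨hh.trans ht.1, ht.2.trans_lt hlt⟩
    refine le_trans (le_of_eq ?_) (ENNReal.rpow_le_rpow hi (by positivity))
    rw [ENNReal.ofReal_rpow_of_nonneg (by positivity) (by positivity), ← Real.rpow_mul (by positivity),
      mul_one_div_cancel hp0.ne', Real.rpow_one]

theorem modf_lower (f : SchwartzMap ℝ ℂ) (m : ℕ) {F F1 L lam a : ℝ} (hF : 0 < F) (hF1 : 0 ≤ F1)
    (hf : eLpNorm f 2 volume = ENNReal.ofReal F)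
    (hf1 : eLpNorm (SchwartzMap.derivCLM ℂ ℂ f) 2 volume = ENNReal.ofReal F1)
    (hL : 1 ≤ L) (hl : 0 < lam) (hlam : 8 * 4 ^ m * Real.pi * F1 / F ≤ lam) :
    ENNReal.ofReal (L ^ (1 / 2 : ℝ) * F / 4) ≤
      eLpNorm (iterDiff (Real.pi / lam) m (modf f L lam a)) 2 volume := by
  have hpi := Real.pi_pos
  have hL0 : 0 < L := by linarith
  have hgc : Continuous (modf f L lam a) := (modf_contDiff f L lam a 0).continuous
  set S := L ^ (1 / 2 : ℝ) with hS
  have hS0 : 0 < S := by positivity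
  have hgfin : eLpNorm (modf f L lam a) 2 volume ≠ ⊤ :=
    ne_top_of_le_ne_top (by rw [hf]; finiteness) (modf_eLpNorm_le f hL0 lam a)
  have hNfin : eLpNorm (iterDiff (Real.pi / lam) m (modf f L lam a)) 2 volume ≠ ⊤ :=
    ne_top_of_le_ne_top (by finiteness) (eLpNorm_iterDiff_le m (Real.pi / lam) hgc)
  have a1 := low_one f L a hl
  rw [eLpNorm_dilate f.continuous hL0, hf] at a1
  have a2 := a1.trans (add_le_add_right (dil_fwd_le f hL _) _)
  have a3 := low_iter m (Real.pi / lam) hgc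
  have a4 := a3.trans (add_le_add_right (mul_le_mul' le_rfl
    ((low_two f L a hl).trans (dil_fwd_le f hL _))) _)
  rw [hf1] at a2 a4
  lift eLpNorm (modf f L lam a) 2 volume to NNReal using hgfin with G
  lift eLpNorm (iterDiff (Real.pi / lam) m (modf f L lam a)) 2 volume to NNReal using hNfin with N
  rw [abs_of_pos (by positivity)] at a2 a4
  rw [← hS] at a2 a4
  have c4 : (4 : ℝ≥0∞) ^ m = ENNReal.ofReal (4 ^ m) := by
    rw [ENNReal.ofReal_pow (by norm_num)]; norm_num
  have c2 : (2 : ℝ≥0∞) = ENNReal.ofReal 2 := by norm_num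
  rw [← ENNReal.ofReal_coe_nnreal, c2, ← ENNReal.ofReal_mul hS0.le, ← ENNReal.ofReal_mul hS0.le,
    ← ENNReal.ofReal_mul (by positivity), ← ENNReal.ofReal_mul (by positivity),
    ← ENNReal.ofReal_add (by positivity) (by positivity),
    ENNReal.ofReal_le_ofReal_iff (by positivity)] at a2
  rw [← ENNReal.ofReal_coe_nnreal, ← ENNReal.ofReal_coe_nnreal, c4, ← ENNReal.ofReal_mul hS0.le,
    ← ENNReal.ofReal_mul (by positivity), ← ENNReal.ofReal_mul (by positivity),
    ← ENNReal.ofReal_add (by positivity) (by positivity),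
    ENNReal.ofReal_le_ofReal_iff (by positivity)] at a4
  rw [← ENNReal.ofReal_coe_nnreal]
  apply ENNReal.ofReal_le_ofReal
  have h4 : (1 : ℝ) ≤ 4 ^ m := one_le_pow₀ (by norm_num)
  set y := Real.pi / lam * (S * F1) with hy
  have hy0 : 0 ≤ y := by positivity
  have e1 : Real.pi / (2 * lam) * (S * F1) = y / 2 := by rw [hy]; field_simp
  rw [e1] at a2
  have hy1 : 8 * 4 ^ m * y ≤ S * F := by
    rw [div_le_iff₀ hF] at hlam
    have : 8 * 4 ^ m * y = S * (8 * 4 ^ m * Real.pi * F1 / lam) := by rw [hy]; ring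
    rw [this]
    gcongr
    rw [div_le_iff₀ hl]
    linarith
  nlinarith [mul_le_mul_of_nonneg_right h4 hy0]

theorem modf_besov (σ : ℝ) (hσ : 0 < σ) (q : ℝ≥0∞) (hq : 2 ≤ q)
    (δ : ℝ) (hδ : 0 < δ) (m : ℕ) (hm : σ < m) (f : SchwartzMap ℝ ℂ) :
    ∃ c C : ℝ, 0 < c ∧ 0 < C ∧ ∃ Λ : ℝ, 1 ≤ Λ ∧
      ∀ lam : ℝ, Λ ≤ lam → ∀ a : ℝ,
        (ENNReal.ofReal (c * lam ^ (σ + δ / 2)) * eLpNorm (f : ℝ → ℂ) 2 volume ≤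
            besovDiffNorm σ q m (modf f (lam ^ δ) lam a) ∧
          besovDiffNorm σ q m (modf f (lam ^ δ) lam a) ≤
            ENNReal.ofReal (C * lam ^ (σ + δ / 2)) * eLpNorm (f : ℝ → ℂ) 2 volume) := by
  obtain ⟨C0, hC0, HU⟩ := upper_besov hσ hm hq
  obtain ⟨F, hF, hf⟩ : ∃ F : ℝ, 0 ≤ F ∧ eLpNorm f 2 volume = ENNReal.ofReal F :=
    ⟨_, ENNReal.toReal_nonneg, (ENNReal.ofReal_toReal (f.memLp 2 volume).2.ne).symm⟩
  obtain ⟨F1, hF1, hf1⟩ : ∃ F1 : ℝ, 0 ≤ F1 ∧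
      eLpNorm (SchwartzMap.derivCLM ℂ ℂ f) 2 volume = ENNReal.ofReal F1 :=
    ⟨_, ENNReal.toReal_nonneg,
      (ENNReal.ofReal_toReal ((SchwartzMap.derivCLM ℂ ℂ f).memLp 2 volume).2.ne).symm⟩
  obtain ⟨K, hK, HK⟩ := modf_iteratedDeriv m f
  have hpi := Real.pi_pos
  rcases hF.eq_or_lt with hF0 | hF0
  · refine ⟨1, 1, one_pos, one_pos, 1, le_rfl, fun lam hl a => ?_⟩
    have h0 : eLpNorm f 2 volume = 0 := by rw [hf, ← hF0]; simp
    rw [h0, mul_zero]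
    refine ⟨zero_le, ?_⟩
    have hl0 : 0 < lam := by linarith
    have hg : eLpNorm (modf f (lam ^ δ) lam a) 2 volume ≤ 0 := by
      have := modf_eLpNorm_le f (Real.rpow_pos_of_pos hl0 δ) lam a
      rwa [h0, mul_zero] at this
    have hi : ∀ h, eLpNorm (iterDiff h m (modf f (lam ^ δ) lam a)) 2 volume ≤ 0 := by
      intro h
      refine (eLpNorm_iterDiff_le m h (modf_contDiff f _ lam a 0).continuous).trans ?_
      rw [nonpos_iff_eq_zero.1 hg, mul_zero]
    have := HU (modf f (lam ^ δ) lam a) 0 lam le_rfl hl (by simpa using hg) (by simpa using hi)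
      (by simpa using hi)
    simpa using this
  · refine ⟨(2 * Real.pi) ^ (-σ) / 2 / 4, C0 * (2 ^ m * F + K) / F, by positivity, by positivity,
      2 * Real.pi + 1 + 8 * 4 ^ m * Real.pi * F1 / F, ?_, fun lam hl a => ?_⟩
    · have : 0 ≤ 8 * 4 ^ m * Real.pi * F1 / F := by positivity
      linarith
    have hx : 0 ≤ 8 * 4 ^ m * Real.pi * F1 / F := by positivity
    have hl1 : 1 ≤ lam := by linarith
    have hl0 : 0 < lam := by linarith
    have hL : 1 ≤ lam ^ δ := Real.one_le_rpow hl1 hδ.le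
    have hS : (lam ^ δ) ^ (1 / 2 : ℝ) = lam ^ (δ / 2) := by
      rw [← Real.rpow_mul hl0.le]; congr 1; ring
    have hgc : Continuous (modf f (lam ^ δ) lam a) := (modf_contDiff f _ lam a 0).continuous
    rw [hf, ← ENNReal.ofReal_mul (by positivity), ← ENNReal.ofReal_mul (by positivity),
      Real.rpow_add hl0]
    constructor
    · have h1 := modf_lower f m (a := a) hF0 hF1 hf hf1 hL hl0 (by linarith)
      have h2 := lower_besov hσ hq _ (by positivity) (by linarith) h1
      rw [hS] at h2
      refine le_trans (le_of_eq ?_) h2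
      congr 1
      ring
    · have hg := modf_eLpNorm_le f (by linarith : 0 < lam ^ δ) lam a
      rw [hS, hf, ← ENNReal.ofReal_mul (by positivity)] at hg
      have h2m : (1 : ℝ) ≤ 2 ^ m := one_le_pow₀ (by norm_num)
      have hSp : 0 < lam ^ (δ / 2) := by positivity
      have hu := HU (modf f (lam ^ δ) lam a) ((2 ^ m * F + K) * lam ^ (δ / 2)) lam
        (by positivity) hl1 ?_ ?_ ?_
      · refine hu.trans (le_of_eq ?_)
        congr 1
        field_simp
      · refine hg.trans (ENNReal.ofReal_le_ofReal ?_)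
        rw [mul_comm]
        gcongr
        nlinarith
      · intro h
        refine ((eLpNorm_iterDiff_le m h hgc).trans (mul_le_mul' le_rfl hg)).trans ?_
        have c2 : (2 : ℝ≥0∞) ^ m = ENNReal.ofReal (2 ^ m) := by
          rw [ENNReal.ofReal_pow (by norm_num)]; norm_num
        rw [c2, ← ENNReal.ofReal_mul (by positivity)]
        apply ENNReal.ofReal_le_ofReal
        nlinarith [mul_nonneg hK hSp.le]
      · intro h
        refine ((eLpNorm_iterDiff_le_deriv m h (modf_contDiff f _ lam a m)).trans
          (mul_le_mul' le_rfl (HK _ hL lam hl1 a))).trans ?_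
        rw [hS, ← ENNReal.ofReal_pow (abs_nonneg _), ← ENNReal.ofReal_mul (by positivity)]
        apply ENNReal.ofReal_le_ofReal
        rw [mul_pow]
        have : 0 ≤ 2 ^ m * F * lam ^ (δ / 2) * (lam ^ m * |h| ^ m) := by positivity
        nlinarith

/-- For `σ > 0`, `2 ≤ q ≤ ∞`, `δ > 0`, `a ∈ ℝ` and `f` Schwartz, for `λ ≫ 1`:
`‖f(·/λ^δ) cos(λ· - a)‖_{B^σ_{2,q}(ℝ)} ≍ λ^{σ + δ/2} ‖f‖_{L²(ℝ)}`, with implicit constants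
independent of `λ` and `a`; the same holds with `sin` in place of `cos`. -/
theorem besov_norm_modulated_dilation (σ : ℝ) (hσ : 0 < σ) (q : ℝ≥0∞) (hq : 2 ≤ q)
    (δ : ℝ) (hδ : 0 < δ) (m : ℕ) (hm : σ < m) (f : SchwartzMap ℝ ℂ) :
    ∃ c C : ℝ, 0 < c ∧ 0 < C ∧ ∃ Λ : ℝ, 1 ≤ Λ ∧
      ∀ lam : ℝ, Λ ≤ lam → ∀ a : ℝ,
        (ENNReal.ofReal (c * lam ^ (σ + δ / 2)) * eLpNorm (f : ℝ → ℂ) 2 volume ≤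
            besovDiffNorm σ q m (fun x => f (x / lam ^ δ) * (Real.cos (lam * x - a) : ℂ)) ∧
          besovDiffNorm σ q m (fun x => f (x / lam ^ δ) * (Real.cos (lam * x - a) : ℂ)) ≤
            ENNReal.ofReal (C * lam ^ (σ + δ / 2)) * eLpNorm (f : ℝ → ℂ) 2 volume) ∧
        (ENNReal.ofReal (c * lam ^ (σ + δ / 2)) * eLpNorm (f : ℝ → ℂ) 2 volume ≤
            besovDiffNorm σ q m (fun x => f (x / lam ^ δ) * (Real.sin (lam * x - a) : ℂ)) ∧
          besovDiffNorm σ q m (fun x => f (x / lam ^ δ) * (Real.sin (lam * x - a) : ℂ)) ≤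
            ENNReal.ofReal (C * lam ^ (σ + δ / 2)) * eLpNorm (f : ℝ → ℂ) 2 volume) := by
  obtain ⟨c, C, hc, hC, Λ, hΛ, H⟩ := modf_besov σ hσ q hq δ hδ m hm f
  refine ⟨c, C, hc, hC, Λ, hΛ, fun lam hl a => ⟨H lam hl a, ?_⟩⟩
  have e : (fun x => f (x / lam ^ δ) * (Real.sin (lam * x - a) : ℂ)) =
      modf f (lam ^ δ) lam (a + Real.pi / 2) := by
    ext x
    unfold modf
    rw [← sub_sub, Real.cos_sub_pi_div_two]
  rw [e]
  exact H lam hl (a + Real.pi / 2)
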